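/- For every g ∈ D(A*), the maps Γ₀ε and Γ₁ε± converge strongly to the canonical boundary maps: as ε → 0⁺, Γ₁ε⁻ g → P_{ker A*}(A* g), Γ₁ε⁺ g → P_{ker A*}(A* g), and Γ₀ε g → g − B(A* g) in the norm of H, where Γ₀ε g := Υε g − B(A*(Υε g)). -/

import Mathlib

open Complex Filter
open scoped ComplexInnerProductSpace

noncomputable section

variable {H : Type*} [NormedAddCommGroup H] [InnerProductSpace ℂ H] [CompleteSpace H]

/-- The eigenspace `ker (T - z·1)` of a partially defined linear operator `T`. -/
def pKer (T : H →ₗ.[ℂ] H) (z : ℂ) : Submodule ℂ H where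
  carrier := {u : H | ∃ hu : u ∈ T.domain, T ⟨u, hu⟩ = z • u}
  zero_mem' := ⟨T.domain.zero_mem, by
    have h0 : (⟨0, T.domain.zero_mem⟩ : T.domain) = 0 := rfl
    rw [h0, T.map_zero, smul_zero]⟩
  add_mem' := by
    rintro a b ⟨ha, hTa⟩ ⟨hb, hTb⟩
    refine ⟨T.domain.add_mem ha hb, ?_⟩
    have h : (⟨a + b, T.domain.add_mem ha hb⟩ : T.domain) = ⟨a, ha⟩ + ⟨b, hb⟩ := rfl
    rw [h, T.map_add, hTa, hTb, smul_add]
  smul_mem' := by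
    rintro c a ⟨ha, hTa⟩
    refine ⟨T.domain.smul_mem c ha, ?_⟩
    have h : (⟨c • a, T.domain.smul_mem c ha⟩ : T.domain) = c • (⟨a, ha⟩ : T.domain) := rfl
    rw [h, T.map_smul, hTa, smul_comm]

/-- Orthogonal projection onto a closed submodule, as a map `H →L[ℂ] H`. -/
def projCl (W : Submodule ℂ H) (hW : IsClosed (W : Set H)) : H →L[ℂ] H :=
  letI : CompleteSpace W := hW.completeSpace_coe
  W.subtypeL.comp (Submodule.orthogonalProjectionOnto W)

/-- The boundary map `Γ₁ε⁻ g = P_{ker(T - iε)} (T g + iε g)`. -/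
def Gamma1m (T : H →ₗ.[ℂ] H) (hker : ∀ z : ℂ, IsClosed ((pKer T z : Set H)))
    (ε : ℝ) (g : T.domain) : H :=
  projCl (pKer T ((ε : ℂ) * I)) (hker _) (T g + ((ε : ℂ) * I) • (g : H))

/-- The boundary map `Γ₁ε⁺ g = P_{ker(T + iε)} (T g - iε g)`. -/
def Gamma1p (T : H →ₗ.[ℂ] H) (hker : ∀ z : ℂ, IsClosed ((pKer T z : Set H)))
    (ε : ℝ) (g : T.domain) : H :=
  projCl (pKer T (-((ε : ℂ) * I))) (hker _) (T g - ((ε : ℂ) * I) • (g : H))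

/-- The map `Υε g = (2iε)⁻¹ (Γ₁ε⁻ g - Γ₁ε⁺ g)`. -/
def Ups (T : H →ₗ.[ℂ] H) (hker : ∀ z : ℂ, IsClosed ((pKer T z : Set H)))
    (ε : ℝ) (g : T.domain) : H :=
  (2 * (ε : ℂ) * I)⁻¹ • (Gamma1m T hker ε g - Gamma1p T hker ε g)

theorem projCl_mem (W : Submodule ℂ H) (hW : IsClosed (W : Set H)) (x : H) :
    projCl W hW x ∈ W :=
  letI : CompleteSpace W := hW.completeSpace_coe
  (W.orthogonalProjectionOnto x).2

theorem sub_projCl_mem_orthogonal (W : Submodule ℂ H) (hW : IsClosed (W : Set H)) (x : H) :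
    x - projCl W hW x ∈ Wᗮ :=
  letI : CompleteSpace W := hW.completeSpace_coe
  W.sub_starProjection_mem_orthogonal x

theorem projCl_eq_of_mem_orthogonal {W : Submodule ℂ H} (hW : IsClosed (W : Set H)) {x y : H}
    (hy : y ∈ W) (hxy : x - y ∈ Wᗮ) : projCl W hW x = y :=
  letI : CompleteSpace W := hW.completeSpace_coe
  W.eq_starProjection_of_mem_orthogonal hy hxy

theorem norm_projCl_apply_le (W : Submodule ℂ H) (hW : IsClosed (W : Set H)) (x : H) :
    ‖projCl W hW x‖ ≤ ‖x‖ :=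
  letI : CompleteSpace W := hW.completeSpace_coe
  W.norm_starProjection_apply_le x

/-- The range of `T + z`, for a partially defined operator `T`. -/
def rangeAddSMul (T : H →ₗ.[ℂ] H) (z : ℂ) : Submodule ℂ H :=
  LinearMap.range (T.toFun + z • T.domain.subtype)

theorem mem_rangeAddSMul {T : H →ₗ.[ℂ] H} {z : ℂ} {y : H} :
    y ∈ rangeAddSMul T z ↔ ∃ f : T.domain, T f + z • (f : H) = y :=
  Iff.rfl

theorem orthogonal_rangeAddSMul {A : H →ₗ.[ℂ] H} (hdense : Dense (A.domain : Set H)) {z : ℂ}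
    (hz : z.re = 0) : (rangeAddSMul A z)ᗮ = pKer A.adjoint z := by
  have hconj : (starRingEnd ℂ) z = -z := by
    apply Complex.ext <;> simp [hz]
  ext y
  rw [Submodule.mem_orthogonal']
  constructor
  · intro h
    have key : ∀ f : A.domain, ⟪z • y, (f : H)⟫ = ⟪y, A f⟫ := fun f => by
      have := h _ (mem_rangeAddSMul.2 ⟨f, rfl⟩)
      rw [inner_add_right, inner_smul_right] at this
      rw [inner_smul_left, hconj]
      linear_combination -this
    exact ⟨LinearPMap.mem_adjoint_domain_of_exists y ⟨_, key⟩,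
      LinearPMap.adjoint_apply_eq hdense _ key⟩
  · rintro ⟨hy, hAy⟩ _ ⟨f, rfl⟩
    have := LinearPMap.adjoint_isFormalAdjoint hdense ⟨y, hy⟩ f
    rw [hAy, inner_smul_left, hconj] at this
    change ⟪y, A f + z • (f : H)⟫ = 0
    rw [inner_add_right, inner_smul_right]
    linear_combination -this

theorem norm_apply_le_norm_add_smul {A : H →ₗ.[ℂ] H}
    (hsym : ∀ f g : A.domain, ⟪(f : H), (A g : H)⟫ = ⟪(A f : H), (g : H)⟫)
    {z : ℂ} (hz : z.re = 0) (f : A.domain) : ‖A f‖ ≤ ‖A f + z • (f : H)‖ := by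
  have him : (⟪A f, (f : H)⟫).im = 0 := by
    have h : (starRingEnd ℂ) ⟪A f, (f : H)⟫ = ⟪A f, (f : H)⟫ := by
      rw [inner_conj_symm, hsym]
    exact Complex.conj_eq_iff_im.1 h
  have hcross : RCLike.re ⟪A f, z • (f : H)⟫ = 0 := by
    rw [inner_smul_right]
    simp [hz, him]
  have h := norm_add_sq (𝕜 := ℂ) (A f) (z • (f : H))
  rw [hcross] at h
  refine le_of_sq_le_sq ?_ (norm_nonneg _)
  nlinarith [sq_nonneg ‖z • (f : H)‖]

theorem isClosed_rangeAddSMul {T : H →ₗ.[ℂ] H} (hclosed : T.IsClosed) {z : ℂ} {C : ℝ}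
    (hbound : ∀ f : T.domain, ‖(f : H)‖ ≤ C * ‖T f + z • (f : H)‖) :
    IsClosed (rangeAddSMul T z : Set H) := by
  refine IsSeqClosed.isClosed fun u y hu huy => ?_
  choose f hf using fun n => mem_rangeAddSMul.1 (hu n)
  have hcauchy : CauchySeq fun n => (f n : H) := by
    have hC : ∀ m n, dist (f m : H) (f n) ≤ C * dist (u m) (u n) := fun m n => by
      have h := hbound (f m - f n)
      rw [LinearPMap.map_sub] at h
      have hsub : T (f m) - T (f n) + z • ((f m - f n : T.domain) : H) = u m - u n := by
        rw [← hf, ← hf, Submodule.coe_sub, smul_sub]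
        abel
      rwa [hsub, Submodule.coe_sub, ← dist_eq_norm, ← dist_eq_norm] at h
    have hu' := cauchySeq_iff_tendsto_dist_atTop_0.1 huy.cauchySeq
    refine cauchySeq_iff_tendsto_dist_atTop_0.2 ?_
    refine squeeze_zero (fun _ => dist_nonneg) (fun p => hC p.1 p.2) ?_
    simpa using hu'.const_mul C
  obtain ⟨x, hx⟩ := cauchySeq_tendsto_of_complete hcauchy
  have hTf : Tendsto (fun n => T (f n)) atTop (nhds (y - z • x)) := by
    refine (huy.sub (hx.const_smul z)).congr fun n => ?_
    rw [← hf n, add_sub_cancel_right]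
  have hgraph : (x, y - z • x) ∈ T.graph :=
    hclosed.mem_of_tendsto (hx.prodMk_nhds hTf) (Eventually.of_forall fun n => T.mem_graph (f n))
  obtain ⟨f₀, hf₀, hTf₀⟩ := (LinearPMap.mem_graph_iff T).1 hgraph
  refine mem_rangeAddSMul.2 ⟨f₀, ?_⟩
  rw [hTf₀, hf₀]
  exact sub_add_cancel _ _

section SymmetricBoundedBelow

variable {A : H →ₗ.[ℂ] H} {C : ℝ}

theorem norm_le_norm_add_smul
    (hsym : ∀ f g : A.domain, ⟪(f : H), (A g : H)⟫ = ⟪(A f : H), (g : H)⟫)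
    (hC : 0 < C) (hbound : ∀ f : A.domain, ‖(f : H)‖ ≤ C * ‖A f‖) {z : ℂ} (hz : z.re = 0)
    (f : A.domain) : ‖(f : H)‖ ≤ C * ‖A f + z • (f : H)‖ :=
  (hbound f).trans (mul_le_mul_of_nonneg_left (norm_apply_le_norm_add_smul hsym hz f) hC.le)

theorem orthogonal_pKer_adjoint (hdense : Dense (A.domain : Set H)) (hclosed : A.IsClosed)
    (hsym : ∀ f g : A.domain, ⟪(f : H), (A g : H)⟫ = ⟪(A f : H), (g : H)⟫)
    (hC : 0 < C) (hbound : ∀ f : A.domain, ‖(f : H)‖ ≤ C * ‖A f‖) {z : ℂ} (hz : z.re = 0) :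
    (pKer A.adjoint z)ᗮ = rangeAddSMul A z := by
  have hcl := isClosed_rangeAddSMul hclosed (norm_le_norm_add_smul hsym hC hbound hz)
  have : CompleteSpace (rangeAddSMul A z) := hcl.completeSpace_coe
  rw [← orthogonal_rangeAddSMul hdense hz, Submodule.orthogonal_orthogonal]

theorem projCl_add_smul_eq_zero (hdense : Dense (A.domain : Set H)) {z : ℂ} (hz : z.re = 0)
    (hW : IsClosed (pKer A.adjoint z : Set H)) (f : A.domain) :
    projCl (pKer A.adjoint z) hW (A f + z • (f : H)) = 0 := by
  refine projCl_eq_of_mem_orthogonal hW (Submodule.zero_mem _) ?_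
  rw [sub_zero, ← orthogonal_rangeAddSMul hdense hz]
  exact Submodule.le_orthogonal_orthogonal _ (mem_rangeAddSMul.2 ⟨f, rfl⟩)

theorem exists_sub_projCl_eq (hdense : Dense (A.domain : Set H)) (hclosed : A.IsClosed)
    (hsym : ∀ f g : A.domain, ⟪(f : H), (A g : H)⟫ = ⟪(A f : H), (g : H)⟫)
    (hC : 0 < C) (hbound : ∀ f : A.domain, ‖(f : H)‖ ≤ C * ‖A f‖) {z : ℂ} (hz : z.re = 0)
    (hW : IsClosed (pKer A.adjoint z : Set H)) (h : H) :
    ∃ f : A.domain, A f + z • (f : H) = h - projCl (pKer A.adjoint z) hW h := by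
  have hmem := sub_projCl_mem_orthogonal _ hW h
  rw [orthogonal_pKer_adjoint hdense hclosed hsym hC hbound hz] at hmem
  exact mem_rangeAddSMul.1 hmem

/-- Vectors in `ker A*` are close to `ker (A* - z)` for small imaginary `z`. -/
theorem norm_sub_projCl_le (hdense : Dense (A.domain : Set H)) (hclosed : A.IsClosed)
    (hsym : ∀ f g : A.domain, ⟪(f : H), (A g : H)⟫ = ⟪(A f : H), (g : H)⟫)
    (hC : 0 < C) (hbound : ∀ f : A.domain, ‖(f : H)‖ ≤ C * ‖A f‖) {z : ℂ} (hz : z.re = 0)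
    (hW : IsClosed (pKer A.adjoint z : Set H)) {k : H} (hk : k ∈ pKer A.adjoint 0) :
    ‖k - projCl (pKer A.adjoint z) hW k‖ ≤ ‖z‖ * (C * ‖k‖) := by
  obtain ⟨f, hf⟩ := exists_sub_projCl_eq hdense hclosed hsym hC hbound hz hW k
  set d := k - projCl (pKer A.adjoint z) hW k with hd
  have hfd : ‖(f : H)‖ ≤ C * ‖d‖ := hf ▸ norm_le_norm_add_smul hsym hC hbound hz f
  have hk0 : ⟪k, A f⟫ = 0 := by
    obtain ⟨hk', hAk⟩ := hk
    have := LinearPMap.adjoint_isFormalAdjoint hdense ⟨k, hk'⟩ f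
    rw [hAk, zero_smul, inner_zero_left] at this
    exact this.symm
  have hdd : ⟪d, d⟫ = z * ⟪k, (f : H)⟫ := by
    have h1 : ⟪projCl (pKer A.adjoint z) hW k, d⟫ = 0 :=
      (Submodule.mem_orthogonal _ _).1 (sub_projCl_mem_orthogonal _ hW k) _ (projCl_mem _ hW k)
    have h2 : ⟪d, d⟫ = ⟪k, d⟫ := by
      conv_lhs => rw [hd, inner_sub_left, ← hd, h1, sub_zero]
    rw [h2, ← hf, inner_add_right, hk0, inner_smul_right, zero_add]
  have hsq : ‖d‖ * ‖d‖ ≤ (‖z‖ * (C * ‖k‖)) * ‖d‖ := by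
    calc ‖d‖ * ‖d‖ = ‖⟪d, d⟫‖ := by
          rw [inner_self_eq_norm_sq_to_K]; simp [pow_two]
      _ = ‖z‖ * ‖⟪k, (f : H)⟫‖ := by rw [hdd, norm_mul]
      _ ≤ ‖z‖ * (‖k‖ * (C * ‖d‖)) := by
          gcongr
          exact (norm_inner_le_norm _ _).trans (by gcongr)
      _ = _ := by ring
  rcases (norm_nonneg d).eq_or_lt with h0 | h0
  · rw [← h0]; positivity
  · exact le_of_mul_le_mul_right hsq h0

theorem tendsto_projCl_add_smul (hdense : Dense (A.domain : Set H)) (hclosed : A.IsClosed)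
    (hsym : ∀ f g : A.domain, ⟪(f : H), (A g : H)⟫ = ⟪(A f : H), (g : H)⟫)
    (hC : 0 < C) (hbound : ∀ f : A.domain, ‖(f : H)‖ ≤ C * ‖A f‖)
    (hker : ∀ z : ℂ, IsClosed (pKer A.adjoint z : Set H)) (h g : H) :
    Tendsto (fun z : ℂ => projCl (pKer A.adjoint z) (hker z) (h + z • g))
      (nhdsWithin 0 {z | z.re = 0}) (nhds (projCl (pKer A.adjoint 0) (hker 0) h)) := by
  obtain ⟨f, hf⟩ := exists_sub_projCl_eq hdense hclosed hsym hC hbound Complex.zero_re (hker 0) h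
  have hk := projCl_mem _ (hker 0) h
  set k := projCl (pKer A.adjoint 0) (hker 0) h
  have hh : h = k + A f := by
    rw [zero_smul, add_zero] at hf
    rw [hf, add_sub_cancel]
  rw [tendsto_iff_norm_sub_tendsto_zero]
  refine squeeze_zero' (g := fun z : ℂ => ‖z‖ * (C * ‖k‖ + ‖g - f‖))
    (Eventually.of_forall fun _ => norm_nonneg _) ?_ ?_
  · filter_upwards [self_mem_nhdsWithin] with z hz
    have hz' : z.re = 0 := hz
    have hsplit : projCl (pKer A.adjoint z) (hker z) (h + z • g) - k =
        -(k - projCl (pKer A.adjoint z) (hker z) k)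
          + projCl (pKer A.adjoint z) (hker z) (z • (g - f)) := by
      have harg : h + z • g = k + (A f + z • (f : H)) + z • (g - f) := by
        rw [hh, smul_sub]; abel
      rw [harg, map_add, map_add, projCl_add_smul_eq_zero hdense hz']
      abel
    rw [hsplit, mul_add]
    refine (norm_add_le _ _).trans (add_le_add ?_ ?_)
    · rw [norm_neg]
      exact norm_sub_projCl_le hdense hclosed hsym hC hbound hz' (hker z) hk
    · exact (norm_projCl_apply_le _ _ _).trans (norm_smul_le _ _)
  · have : Tendsto (fun z : ℂ => ‖z‖ * (C * ‖k‖ + ‖g - f‖)) (nhds 0)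
        (nhds (‖(0 : ℂ)‖ * (C * ‖k‖ + ‖g - f‖))) :=
      (continuous_norm.mul continuous_const).tendsto 0
    rw [norm_zero, zero_mul] at this
    exact this.mono_left nhdsWithin_le_nhds

/-- The von Neumann decomposition: `g - Υε g` lies in the domain of the symmetric operator. -/
theorem exists_eq_add_Ups (hdense : Dense (A.domain : Set H)) (hclosed : A.IsClosed)
    (hsym : ∀ f g : A.domain, ⟪(f : H), (A g : H)⟫ = ⟪(A f : H), (g : H)⟫)
    (hC : 0 < C) (hbound : ∀ f : A.domain, ‖(f : H)‖ ≤ C * ‖A f‖)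
    (hker : ∀ z : ℂ, IsClosed (pKer A.adjoint z : Set H)) {ε : ℝ} (hε : 0 < ε)
    (g : A.adjoint.domain) :
    ∃ f : A.domain, (g : H) = f + Ups A.adjoint hker ε g := by
  have hle : A ≤ A.adjoint :=
    LinearPMap.IsFormalAdjoint.le_adjoint hdense fun f g => (hsym f g).symm
  set z : ℂ := (ε : ℂ) * I with hzdef
  have hz : z.re = 0 := by simp [hzdef]
  have hnz : (-z).re = 0 := by simp [hz]
  have hz0 : 2 * z ≠ 0 := by simp [hzdef, hε.ne']
  obtain ⟨f, hf⟩ := exists_sub_projCl_eq hdense hclosed hsym hC hbound hz (hker z)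
    (A.adjoint g + z • (g : H))
  have hp : projCl (pKer A.adjoint z) (hker z) (A.adjoint g + z • (g : H)) =
    Gamma1m A.adjoint hker ε g := rfl
  rw [hp] at hf
  have hpmem : Gamma1m A.adjoint hker ε g ∈ pKer A.adjoint z := projCl_mem _ _ _
  set p := Gamma1m A.adjoint hker ε g with hpdef
  have hu := Submodule.smul_mem _ (2 * z)⁻¹ hpmem
  have hpu : p = (2 * z) • ((2 * z)⁻¹ • p) := (smul_inv_smul₀ hz0 p).symm
  set u := (2 * z)⁻¹ • p with hudef
  obtain ⟨hu', hAu⟩ := hu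
  have hfA : (f : H) ∈ A.adjoint.domain := hle.1 f.2
  have hAf : A.adjoint ⟨f, hfA⟩ = A f := (hle.2 rfl).symm
  let v : A.adjoint.domain := g - ⟨f, hfA⟩ - ⟨u, hu'⟩
  have hv : (v : H) = g - f - u := rfl
  have hAv' : A.adjoint v = A.adjoint g - A f - z • u := by
    rw [LinearPMap.map_sub, LinearPMap.map_sub, hAf, hAu]
  have hAv : A.adjoint v = (-z) • (v : H) := by
    have hAf' : A f = A.adjoint g + z • (g : H) - (2 * z) • u - z • (f : H) := by
      rw [← hpu, ← hf, add_sub_cancel_right]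
    rw [hAv', hAf', hv]
    module
  have hq : Gamma1p A.adjoint hker ε g = -((2 * z) • (v : H)) := by
    refine projCl_eq_of_mem_orthogonal _
      (Submodule.neg_mem _ (Submodule.smul_mem _ _ ⟨v.2, hAv⟩)) ?_
    rw [orthogonal_pKer_adjoint hdense hclosed hsym hC hbound hnz]
    refine mem_rangeAddSMul.2 ⟨f, ?_⟩
    have hAg : A.adjoint g = A f + z • u + (-z) • (v : H) := by
      rw [← hAv, hAv']; abel
    rw [hAg, hv]
    module
  refine ⟨f, ?_⟩
  have hUps : Ups A.adjoint hker ε g = u + v := by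
    have h2 : 2 * (ε : ℂ) * I = 2 * z := by rw [hzdef, mul_assoc]
    rw [Ups, h2, hq, ← hpdef, sub_neg_eq_add, smul_add, ← hudef, inv_smul_smul₀ hz0]
  rw [hUps, hv]
  abel

end SymmetricBoundedBelow

theorem statement_9
    (A : H →ₗ.[ℂ] H)
    (hdense : Dense (A.domain : Set H))
    (hclosed : A.IsClosed)
    (hsym : ∀ f g : A.domain, ⟪(f : H), (A g : H)⟫ = ⟪(A f : H), (g : H)⟫)
    (C : ℝ) (hC : 0 < C)
    (hbound : ∀ f : A.domain, ‖(f : H)‖ ≤ C * ‖A f‖)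
    (hker : ∀ z : ℂ, IsClosed ((pKer A.adjoint z : Set H)))
    (SD : H →ₗ.[ℂ] H) (hSDsa : SD.adjoint = SD) (hASD : A ≤ SD)
    (B : H →L[ℂ] H) (b : ℝ) (hb : ‖B‖ = b)
    (hB1 : ∀ x : SD.domain, B (SD x) = x)
    (hB2 : ∀ y : H, ∃ hy : B y ∈ SD.domain, SD ⟨B y, hy⟩ = y)
    (g : A.adjoint.domain)
    (hmem : ∀ ε : ℝ, Ups A.adjoint hker ε g ∈ A.adjoint.domain) :
    Tendsto (fun ε : ℝ => Gamma1m A.adjoint hker ε g)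
      (nhdsWithin 0 (Set.Ioi 0)) (nhds (projCl (pKer A.adjoint 0) (hker 0) (A.adjoint g))) ∧
    Tendsto (fun ε : ℝ => Gamma1p A.adjoint hker ε g)
      (nhdsWithin 0 (Set.Ioi 0)) (nhds (projCl (pKer A.adjoint 0) (hker 0) (A.adjoint g))) ∧
    Tendsto (fun ε : ℝ =>
        Ups A.adjoint hker ε g - B (A.adjoint ⟨Ups A.adjoint hker ε g, hmem ε⟩))
      (nhdsWithin 0 (Set.Ioi 0)) (nhds ((g : H) - B (A.adjoint g))) := by
  have htend := tendsto_projCl_add_smul hdense hclosed hsym hC hbound hker (A.adjoint g) g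
  have hlim : Tendsto (fun ε : ℝ => (ε : ℂ) * I) (nhdsWithin 0 (Set.Ioi 0))
      (nhdsWithin 0 {z | z.re = 0}) := by
    refine tendsto_nhdsWithin_iff.2 ⟨?_, Eventually.of_forall fun ε => by simp⟩
    have : Tendsto (fun ε : ℝ => (ε : ℂ) * I) (nhds 0) (nhds (((0 : ℝ) : ℂ) * I)) :=
      (Complex.continuous_ofReal.mul continuous_const).tendsto 0
    rw [Complex.ofReal_zero, zero_mul] at this
    exact this.mono_left nhdsWithin_le_nhds
  have hlim_neg : Tendsto (fun ε : ℝ => -((ε : ℂ) * I)) (nhdsWithin 0 (Set.Ioi 0))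
      (nhdsWithin 0 {z | z.re = 0}) := by
    refine tendsto_nhdsWithin_iff.2 ⟨?_, Eventually.of_forall fun ε => by simp⟩
    simpa using (tendsto_nhdsWithin_iff.1 hlim).1.neg
  refine ⟨htend.comp hlim, (htend.comp hlim_neg).congr fun ε => ?_, ?_⟩
  · simp only [Function.comp_apply, Gamma1p, neg_smul, sub_eq_add_neg]
  · refine tendsto_const_nhds.congr' ?_
    filter_upwards [self_mem_nhdsWithin] with ε hε
    obtain ⟨f, hf⟩ := exists_eq_add_Ups hdense hclosed hsym hC hbound hker hε g
    have hle : A ≤ A.adjoint :=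
      LinearPMap.IsFormalAdjoint.le_adjoint hdense fun f g => (hsym f g).symm
    have hfA : (f : H) ∈ A.adjoint.domain := hle.1 f.2
    have hAf : A.adjoint ⟨f, hfA⟩ = A f := (hle.2 rfl).symm
    have hBf : B (A f) = f := by
      have hSf : A f = SD ⟨f, hASD.1 f.2⟩ := hASD.2 rfl
      rw [hSf, hB1]
    have hg : g = ⟨f, hfA⟩ + ⟨Ups A.adjoint hker ε g, hmem ε⟩ := Subtype.ext hf
    have hAg : A.adjoint g = A f + A.adjoint ⟨Ups A.adjoint hker ε g, hmem ε⟩ := by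
      conv_lhs => rw [hg, LinearPMap.map_add, hAf]
    rw [hAg, map_add, hBf]
    nth_rewrite 1 [hf]
    abel
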